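/- arXiv:1011.5497 — 4 statements merged into one kernel-verified Lean document; each statement's English description precedes it below -/
import Mathlib

section
/- Let p be an odd prime, m ≥ 1, ξ a primitive p^m-th root of unity over ℚ_p, 𝔬 = ℤ_p[ξ], and let f be a distinguished polynomial over 𝔬 that is irreducible as an element of 𝔬[[T]]. Then the quotient ring 𝔬[[T]]/(f) is a local domain which is a finite free ℤ_p-module, and its residue field has exactly p elements; in particular its fraction field is a totally ramified finite extension of ℚ_p. -/
set_option synthInstance.maxHeartbeats 1000000
set_option maxHeartbeats 1000000

open Polynomial IsLocalRing

/-- A finite module over an adically complete ring is precomplete. -/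
theorem IsPrecomplete.of_module_finite {R M : Type*} [CommRing R] [AddCommGroup M] [Module R M]
    (I : Ideal R) [IsPrecomplete I R] [Module.Finite R M] : IsPrecomplete I M := by
  rw [← AdicCompletion.of_surjective_iff]
  intro y
  obtain ⟨t, rfl⟩ := AdicCompletion.ofTensorProduct_surjective_of_finite I M y
  induction t with
  | zero => exact ⟨0, by simp⟩
  | add a b ha hb =>
    obtain ⟨x, hx⟩ := ha
    obtain ⟨y, hy⟩ := hb
    exact ⟨x + y, by simp [hx, hy]⟩
  | tmul r m =>
    obtain ⟨r, rfl⟩ := AdicCompletion.of_surjective I R r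
    refine ⟨r • m, ?_⟩
    ext n
    rw [AdicCompletion.ofTensorProduct_tmul]
    rfl

/-- Precompleteness only depends on the adic topology. -/
theorem IsPrecomplete.of_le_of_pow_le {R M : Type*} [CommRing R] [AddCommGroup M] [Module R M]
    {I J : Ideal R} {N : ℕ} (hN : 1 ≤ N) (hIJ : I ≤ J) (hJI : J ^ N ≤ I) [hI : IsPrecomplete I M] :
    IsPrecomplete J M := by
  refine ⟨fun f hf ↦ ?_⟩
  obtain ⟨x, hx⟩ := hI.prec (f := fun k ↦ f (N * k)) fun {a b} hab ↦
    (hf (Nat.mul_le_mul_left N hab)).mono <|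
      Submodule.smul_mono_left (by rw [pow_mul]; exact Ideal.pow_right_mono hJI a)
  refine ⟨x, fun n ↦ (hf (Nat.le_mul_of_pos_left n hN)).trans ?_⟩
  exact (hx n).mono (Submodule.smul_mono_left (Ideal.pow_right_mono hIJ n))

/-- A polynomial factor of a distinguished polynomial is a unit as soon as it is a unit in the
ring of power series. -/
theorem Polynomial.IsDistinguishedAt.isUnit_of_isUnit_coe_of_dvd {R : Type*} [CommRing R]
    [IsDomain R] [IsLocalRing R] {f a : R[X]} (hf : f.IsDistinguishedAt (maximalIdeal R)) (hdvd : a ∣ f)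
    (ha : IsUnit (a : PowerSeries R)) : IsUnit a := by
  have hlead : IsUnit a.leadingCoeff := by
    obtain ⟨b, rfl⟩ := hdvd
    exact hf.monic.isUnit_leadingCoeff_of_dvd (Dvd.intro _ rfl)
  have hcoeff : IsUnit (a.coeff 0) := by
    simpa using PowerSeries.isUnit_iff_constantCoeff.mp ha
  have hdeg : (a.map (Ideal.Quotient.mk (maximalIdeal R))).natDegree = a.natDegree :=
    natDegree_map_of_leadingCoeff_ne_zero _ (hlead.map _).ne_zero
  have hmap : a.map (Ideal.Quotient.mk (maximalIdeal R)) ∣ X ^ f.natDegree := by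
    rw [← hf.map_eq_X_pow]
    exact Polynomial.map_dvd _ hdvd
  let := Ideal.Quotient.field (maximalIdeal R)
  obtain ⟨i, -, hi⟩ := (dvd_prime_pow prime_X _).mp hmap
  have hi0 : i = 0 := by
    by_contra h
    have h1 : X ∣ a.map (Ideal.Quotient.mk (maximalIdeal R)) :=
      (dvd_pow_self X h).trans hi.symm.dvd
    rw [X_dvd_iff, coeff_map] at h1
    exact (hcoeff.map _).ne_zero h1
  rw [hi0, pow_zero, associated_one_iff_isUnit] at hi
  rw [natDegree_eq_zero_of_isUnit hi] at hdeg
  rw [eq_C_of_natDegree_eq_zero hdeg.symm]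
  exact isUnit_C.mpr hcoeff

/-- A distinguished polynomial which is irreducible as a power series is irreducible. -/
theorem Polynomial.IsDistinguishedAt.irreducible_of_irreducible_coe {R : Type*} [CommRing R]
    [IsDomain R] [IsLocalRing R] {f : R[X]} (hf : f.IsDistinguishedAt (maximalIdeal R))
    (hirr : Irreducible (f : PowerSeries R)) : Irreducible f where
  not_isUnit h := hirr.not_isUnit (h.map (coeToPowerSeries.ringHom (R := R)))
  isUnit_or_isUnit a b hab := by
    have h : (f : PowerSeries R) = a * b := by rw [hab, coe_mul]
    exact (hirr.isUnit_or_isUnit h).imp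
      (hf.isUnit_of_isUnit_coe_of_dvd ⟨b, hab⟩)
      (hf.isUnit_of_isUnit_coe_of_dvd ⟨a, hab.trans (mul_comm a b)⟩)

/-- A local ring in which every element is congruent to a `p`-adic integer modulo the maximal
ideal has residue field of cardinality `p`. -/
theorem IsLocalRing.card_residueField_eq_of_padicInt {p : ℕ} [Fact p.Prime] {A : Type*}
    [CommRing A] [IsLocalRing A] (φ : ℤ_[p] →+* A)
    (hφ : ∀ a, ∃ n, a - φ n ∈ maximalIdeal A) : Nat.card (ResidueField A) = p := by
  have hsurj : Function.Surjective ((residue A).comp φ) := fun x ↦ by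
    obtain ⟨a, rfl⟩ := residue_surjective x
    obtain ⟨n, hn⟩ := hφ a
    refine ⟨n, ?_⟩
    rw [← residue_eq_zero_iff, map_sub, sub_eq_zero] at hn
    exact hn.symm
  have hker : RingHom.ker ((residue A).comp φ) = maximalIdeal ℤ_[p] :=
    eq_maximalIdeal (RingHom.ker_isMaximal_of_surjective _ hsurj)
  rw [← Nat.card_congr ((Ideal.quotEquivOfEq hker.symm).trans
    (RingHom.quotientKerEquivOfSurjective hsurj)).toEquiv]
  exact (Nat.card_congr PadicInt.residueField.toEquiv).trans (Nat.card_zmod p)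

section Cyclotomic

variable {p : ℕ} [Fact p.Prime] {R : Type*} [CommRing R]

/-- If `ζ` is a `p^m`-th root of unity, then `1 - ζ` is nilpotent modulo `p`. -/
theorem dvd_one_sub_pow_of_pow_eq_one (hp : Odd p) {m : ℕ} {ζ : R} (hζ : ζ ^ p ^ m = 1) :
    (p : R) ∣ (1 - ζ) ^ p ^ m := by
  obtain ⟨r, hr⟩ := exists_add_pow_prime_pow_eq (Fact.out : p.Prime) 1 (-ζ) m
  rw [(hp.pow).neg_pow, hζ, one_pow, add_neg_cancel, zero_add, ← sub_eq_add_neg] at hr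
  exact ⟨-ζ * r, by rw [hr]; ring⟩

theorem IsPrimitiveRoot.one_sub_dvd_prime [IsDomain R] {m : ℕ} (hm : 1 ≤ m) {ζ : R}
    (hζ : IsPrimitiveRoot ζ (p ^ m)) : 1 - ζ ∣ (p : R) := by
  obtain ⟨k, rfl⟩ := Nat.exists_eq_add_of_le' hm
  have h := sub_dvd_eval_sub 1 ζ (cyclotomic (p ^ (k + 1)) R)
  rwa [eval_one_cyclotomic_prime_pow,
    (hζ.isRoot_cyclotomic (pow_pos (Fact.out : p.Prime).pos _)).eq_zero, sub_zero] at h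

variable [Algebra ℤ_[p] R]

theorem exists_one_sub_dvd_sub_algebraMap {ζ : R} (hgen : Algebra.adjoin ℤ_[p] {ζ} = ⊤) (x : R) :
    ∃ n : ℤ_[p], 1 - ζ ∣ x - algebraMap ℤ_[p] R n := by
  have hx : x ∈ Algebra.adjoin ℤ_[p] {ζ} := hgen ▸ Algebra.mem_top
  rw [Algebra.adjoin_singleton_eq_range_aeval] at hx
  obtain ⟨q, rfl⟩ := hx
  refine ⟨q.eval 1, ?_⟩
  have h := sub_dvd_eval_sub ζ 1 (q.map (algebraMap ℤ_[p] R))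
  rw [eval_map_algebraMap, eval_one_map] at h
  rw [← neg_sub ζ 1, neg_dvd]
  exact h

/-- If `R = ℤ_p[ζ]` with `ζ` a `p^m`-th root of unity, then `1 - ζ` lies in
every maximal ideal of `R`. -/
theorem one_sub_mem_of_isMaximal [Algebra.IsIntegral ℤ_[p] R] (hp : Odd p) {m : ℕ} {ζ : R}
    (hζ : ζ ^ p ^ m = 1) (M : Ideal R) [M.IsMaximal] : 1 - ζ ∈ M := by
  have hM : (M.comap (algebraMap ℤ_[p] R)) = maximalIdeal ℤ_[p] :=
    eq_maximalIdeal (Ideal.isMaximal_comap_of_isIntegral_of_isMaximal M)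
  have hpM : (p : R) ∈ M := by
    have : (p : ℤ_[p]) ∈ M.comap (algebraMap ℤ_[p] R) := by
      rw [hM, PadicInt.maximalIdeal_eq_span_p]
      exact Ideal.mem_span_singleton_self _
    simpa using this
  exact Ideal.IsPrime.mem_of_pow_mem inferInstance _
    (M.mem_of_dvd (dvd_one_sub_pow_of_pow_eq_one hp hζ) hpM)

theorem isMaximal_span_one_sub [Nontrivial R] [Algebra.IsIntegral ℤ_[p] R] (hp : Odd p) {m : ℕ}
    {ζ : R} (hζ : ζ ^ p ^ m = 1) (hdvd : 1 - ζ ∣ (p : R))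
    (hgen : Algebra.adjoin ℤ_[p] {ζ} = ⊤) : (Ideal.span {1 - ζ}).IsMaximal := by
  obtain ⟨M, hM⟩ := Ideal.exists_maximal R
  have hle : Ideal.span {1 - ζ} ≤ M :=
    (Ideal.span_singleton_le_iff_mem _).mpr (one_sub_mem_of_isMaximal hp hζ M)
  suffices h : M ≤ Ideal.span {1 - ζ} by rwa [le_antisymm hle h]
  intro x hx
  obtain ⟨n, hn⟩ := exists_one_sub_dvd_sub_algebraMap hgen x
  have hnM : algebraMap ℤ_[p] R n ∈ M := by
    simpa using M.sub_mem hx (hle (Ideal.mem_span_singleton.mpr hn))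
  have hn' : n ∈ maximalIdeal ℤ_[p] :=
    eq_maximalIdeal (Ideal.isMaximal_comap_of_isIntegral_of_isMaximal (R := ℤ_[p]) M) ▸
      Ideal.mem_comap.mpr hnM
  rw [PadicInt.maximalIdeal_eq_span_p, Ideal.mem_span_singleton] at hn'
  have h2 : 1 - ζ ∣ algebraMap ℤ_[p] R n :=
    hdvd.trans (by simpa using map_dvd (algebraMap ℤ_[p] R) hn')
  rw [Ideal.mem_span_singleton]
  simpa using dvd_add hn h2

theorem isLocalRing_of_adjoin_eq_top [Nontrivial R] [Algebra.IsIntegral ℤ_[p] R] (hp : Odd p)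
    {m : ℕ} {ζ : R} (hζ : ζ ^ p ^ m = 1) (hdvd : 1 - ζ ∣ (p : R))
    (hgen : Algebra.adjoin ℤ_[p] {ζ} = ⊤) : IsLocalRing R := by
  have hmax := isMaximal_span_one_sub hp hζ hdvd hgen
  refine .of_unique_max_ideal ⟨_, hmax, fun M hM ↦ (hmax.eq_of_le hM.ne_top ?_).symm⟩
  exact (Ideal.span_singleton_le_iff_mem _).mpr (one_sub_mem_of_isMaximal hp hζ M)

/-- Let `R = ℤ_p[ζ]` with `ζ` a `p^m`-th root of unity, then `R` is adically complete. -/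
theorem isAdicComplete_maximalIdeal_of_maximalIdeal_eq_span [IsLocalRing R] [IsNoetherianRing R]
    [Module.Finite ℤ_[p] R] (hp : Odd p) {m : ℕ} {ζ : R} (hζ : ζ ^ p ^ m = 1)
    (hdvd : 1 - ζ ∣ (p : R)) (hmax : maximalIdeal R = Ideal.span {1 - ζ}) :
    IsAdicComplete (maximalIdeal R) R := by
  have hmap : (maximalIdeal ℤ_[p]).map (algebraMap ℤ_[p] R) = Ideal.span {(p : R)} := by
    simp [PadicInt.maximalIdeal_eq_span_p, Ideal.map_span]
  have hpre : IsPrecomplete (maximalIdeal ℤ_[p]) R := .of_module_finite _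
  rw [← IsPrecomplete.map_algebraMap_iff (S := R), hmap] at hpre
  have : IsPrecomplete (maximalIdeal R) R := by
    refine .of_le_of_pow_le (I := Ideal.span {(p : R)}) (N := p ^ m)
      (Nat.one_le_pow _ _ (Fact.out : p.Prime).pos) ?_ ?_
    · rwa [hmax, Ideal.span_singleton_le_span_singleton]
    · rw [hmax, Ideal.span_singleton_pow, Ideal.span_singleton_le_span_singleton]
      exact dvd_one_sub_pow_of_pow_eq_one hp hζ
  exact {}

end Cyclotomic

/-- Let `p` be an odd prime, `m ≥ 1`, `ξ` a primitive `p^m`-th root of unity over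
`ℚ_p`, `𝔬 = ℤ_p[ξ]` (a local ring whose maximal ideal is generated by `1 - ξ`), and let `f` be a
distinguished polynomial over `𝔬` that is irreducible as an element of `𝔬[[T]]`.  Then the
quotient ring `𝔬[[T]]/(f)` is a local domain which is a finite free `ℤ_p`-module, and its residue
field has exactly `p` elements; in particular its fraction field is a totally ramified finite
extension of `ℚ_p`. -/
theorem stmt_2 (p : ℕ) [Fact (Nat.Prime p)] (hp : Odd p) (m : ℕ) (hm : 1 ≤ m)
    (L : Type) [Field L] [Algebra ℚ_[p] L] [Algebra ℤ_[p] L] [IsScalarTower ℤ_[p] ℚ_[p] L]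
    (ξ : L) (hξ : IsPrimitiveRoot ξ (p ^ m))
    (hL : IntermediateField.adjoin ℚ_[p] ({ξ} : Set L) = ⊤)
    (𝔬 : Subalgebra ℤ_[p] L) (h𝔬 : 𝔬 = Algebra.adjoin ℤ_[p] ({ξ} : Set L))
    (ξ𝔬 : ↥𝔬) (hξ𝔬 : (ξ𝔬 : L) = ξ)
    (f : Polynomial ↥𝔬)
    (hdist : f.Monic ∧ ∀ i < f.natDegree, f.coeff i ∈ Ideal.span {1 - ξ𝔬})
    (hirr : Irreducible (f : PowerSeries ↥𝔬)) :
    ∃ _ : IsLocalRing (PowerSeries ↥𝔬 ⧸ Ideal.span {(f : PowerSeries ↥𝔬)}),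
      IsDomain (PowerSeries ↥𝔬 ⧸ Ideal.span {(f : PowerSeries ↥𝔬)}) ∧
      Module.Finite ℤ_[p] (PowerSeries ↥𝔬 ⧸ Ideal.span {(f : PowerSeries ↥𝔬)}) ∧
      Module.Free ℤ_[p] (PowerSeries ↥𝔬 ⧸ Ideal.span {(f : PowerSeries ↥𝔬)}) ∧
      Nat.card
        (IsLocalRing.ResidueField (PowerSeries ↥𝔬 ⧸ Ideal.span {(f : PowerSeries ↥𝔬)})) = p := by
  have hζ : IsPrimitiveRoot ξ𝔬 (p ^ m) :=
    IsPrimitiveRoot.of_map_of_injective (f := 𝔬.val) (by simpa [hξ𝔬] using hξ)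
      Subtype.val_injective
  have hgen : Algebra.adjoin ℤ_[p] {ξ𝔬} = ⊤ := by
    apply Subalgebra.map_injective (f := 𝔬.val) Subtype.val_injective
    rw [AlgHom.map_adjoin, Algebra.map_top, Subalgebra.range_val, Set.image_singleton]
    simp [hξ𝔬, h𝔬]
  have hinj : Function.Injective (algebraMap ℤ_[p] L) := by
    rw [IsScalarTower.algebraMap_eq ℤ_[p] ℚ_[p] L]
    exact (algebraMap ℚ_[p] L).injective.comp (IsFractionRing.injective ℤ_[p] ℚ_[p])
  have : Module.IsTorsionFree ℤ_[p] L :=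
    (faithfulSMul_iff_algebraMap_injective ℤ_[p] L).mpr hinj |>.to_isTorsionFree
  have hint : IsIntegral ℤ_[p] ξ :=
    hξ.isIntegral (pow_pos (Fact.out : p.Prime).pos _) |>.tower_top
  have : Module.Finite ℤ_[p] 𝔬 := by
    rw [h𝔬]
    exact Algebra.finite_adjoin_simple_of_isIntegral hint
  have : Module.Free ℤ_[p] 𝔬 := Module.free_of_finite_type_torsion_free'
  have : IsNoetherianRing 𝔬 := IsNoetherianRing.of_finite ℤ_[p] 𝔬
  have hdvd := hζ.one_sub_dvd_prime hm
  have : IsLocalRing 𝔬 := isLocalRing_of_adjoin_eq_top hp hζ.pow_eq_one hdvd hgen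
  have hmax : maximalIdeal 𝔬 = Ideal.span {1 - ξ𝔬} :=
    (eq_maximalIdeal (isMaximal_span_one_sub hp hζ.pow_eq_one hdvd hgen)).symm
  have : IsAdicComplete (maximalIdeal 𝔬) 𝔬 :=
    isAdicComplete_maximalIdeal_of_maximalIdeal_eq_span hp hζ.pow_eq_one hdvd hmax
  have : IsPrincipalIdealRing 𝔬 :=
    ((tfae_of_isNoetherianRing_of_isLocalRing_of_isDomain 𝔬).out 4 0).mp
      (show (maximalIdeal 𝔬).IsPrincipal from ⟨1 - ξ𝔬, hmax⟩)
  have hf : f.IsDistinguishedAt (maximalIdeal 𝔬) :=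
    { monic := hdist.1, mem := fun {i} hi ↦ hmax ▸ hdist.2 i hi }
  have hprime : Prime f := (hf.irreducible_of_irreducible_coe hirr).prime
  have : (Ideal.span {f}).IsPrime := (Ideal.span_singleton_prime hprime.ne_zero).mpr hprime
  have : Module.Free 𝔬 (𝔬[X] ⧸ Ideal.span {f}) := hdist.1.free_quotient
  have : Module.Finite 𝔬 (𝔬[X] ⧸ Ideal.span {f}) := hdist.1.finite_quotient
  let e := hf.algEquivQuotient
  have hdom : IsDomain (PowerSeries 𝔬 ⧸ Ideal.span {(f : PowerSeries 𝔬)}) :=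
    e.symm.toMulEquiv.isDomain _
  have : Module.Free 𝔬 (PowerSeries 𝔬 ⧸ Ideal.span {(f : PowerSeries 𝔬)}) :=
    .of_equiv e.toLinearEquiv
  have : Module.Finite 𝔬 (PowerSeries 𝔬 ⧸ Ideal.span {(f : PowerSeries 𝔬)}) :=
    .equiv e.toLinearEquiv
  have hloc : IsLocalRing (PowerSeries 𝔬 ⧸ Ideal.span {(f : PowerSeries 𝔬)}) :=
    .of_surjective' _ Ideal.Quotient.mk_surjective
  refine ⟨hloc, hdom, .trans 𝔬 _, .trans (S := 𝔬), ?_⟩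
  refine card_residueField_eq_of_padicInt
    ((Ideal.Quotient.mk _).comp ((PowerSeries.C (R := 𝔬)).comp (algebraMap ℤ_[p] 𝔬))) fun a ↦ ?_
  obtain ⟨g, rfl⟩ := Ideal.Quotient.mk_surjective a
  obtain ⟨n, hn⟩ := exists_one_sub_dvd_sub_algebraMap hgen (PowerSeries.constantCoeff g)
  refine ⟨n, ?_⟩
  have hg : g - PowerSeries.C (algebraMap ℤ_[p] 𝔬 n) ∈ maximalIdeal (PowerSeries 𝔬) := by
    rw [mem_maximalIdeal, mem_nonunits_iff, PowerSeries.isUnit_iff_constantCoeff,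
      ← mem_nonunits_iff, ← mem_maximalIdeal, hmax, Ideal.mem_span_singleton]
    simpa using hn
  rw [RingHom.comp_apply, RingHom.comp_apply, ← map_sub]
  rw [← map_maximalIdeal_of_surjective _ Ideal.Quotient.mk_surjective]
  exact Ideal.mem_map_of_mem _ hg
end

section
/- Let p be an odd prime, n > r ≥ 1, ζ a primitive p^n-th root of unity over ℚ_p, ξ = ζ^{p^r}, L = ℚ_p(ξ). Set K = Frac(ℤ_p[ξ][[T]]) and M = Frac(ℤ_p[ζ][[T]]), a Galois extension of K of degree p^r via the coefficientwise inclusion, with norm map N = N_{M/K}. Then the image of the element 1 + T in the quotient group K^× / N(M^×) has order exactly p^r; equivalently, N(1 + T) = (1 + T)^{p^r}, and for every integer t with 0 ≤ t < r there is no a ∈ M with N(a) = (1 + T)^{p^t}. -/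
set_option synthInstance.maxHeartbeats 1000000
set_option maxHeartbeats 1000000

open Module Polynomial

section PureExtension

variable {S R : Type} [CommRing S] [IsDomain S] [CommRing R] [IsDomain R] [Algebra S R]
  {q : ℕ} {x : S} {z : R}

theorem minpoly_eq_X_pow_sub_C (b : Basis (Fin q) S R) (hb : ∀ i, b i = z ^ (i : ℕ))
    (hz : z ^ q = algebraMap S R x) : minpoly S z = X ^ q - C x := by
  let pb : PowerBasis S R := ⟨z, q, b, hb⟩
  have hq : 0 < q := Fin.pos_iff_nonempty.mpr b.index_nonempty
  have hm : (minpoly S z).Monic := minpoly.monic pb.isIntegral_gen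
  have hdm : (minpoly S z).natDegree = q := pb.natDegree_minpoly
  have hm' : (X ^ q - C x).Monic := monic_X_pow_sub_C x hq.ne'
  by_contra hne
  have h0 : minpoly S z - (X ^ q - C x) ≠ 0 := sub_ne_zero.mpr hne
  have hroot : aeval pb.gen (minpoly S z - (X ^ q - C x)) = 0 := by
    change aeval z _ = 0
    simp [hz]
  have hle : q ≤ _ := pb.dim_le_natDegree_of_root h0 hroot
  have hd : (minpoly S z).degree = (X ^ q - C x).degree := by
    rw [degree_eq_natDegree hm.ne_zero, hdm, degree_X_pow_sub_C hq]
  have hlt := degree_sub_lt_left hd hm.ne_zero (by rw [hm.leadingCoeff, hm'.leadingCoeff])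
  have := natDegree_lt_natDegree h0 hlt
  omega

theorem norm_one_sub_eq (b : Basis (Fin q) S R) (hb : ∀ i, b i = z ^ (i : ℕ))
    (hz : z ^ q = algebraMap S R x) : Algebra.norm S (1 - z) = 1 - x := by
  let pb : PowerBasis S R := ⟨z, q, b, hb⟩
  have h1 := charpoly_leftMulMatrix pb
  change _ = minpoly S z at h1
  rw [minpoly_eq_X_pow_sub_C b hb hz] at h1
  have h2 := congrArg (eval 1) h1
  rw [Matrix.eval_charpoly] at h2
  rw [Algebra.norm_eq_matrix_det pb.basis, map_sub, map_one]
  simpa [pb] using h2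

omit [IsDomain S] [IsDomain R] in
theorem dvd_trace (b : Basis (Fin q) S R) (hb : ∀ i, b i = z ^ (i : ℕ))
    (hz : z ^ q = algebraMap S R x) (y : R) : (q : S) ∣ Algebra.trace S R y := by
  rw [← b.sum_repr y, map_sum]
  refine Finset.dvd_sum fun i _ => ?_
  rw [map_smul, smul_eq_mul]
  refine Dvd.dvd.mul_left ?_ _
  by_cases hi : (i : ℕ) = 0
  · rw [hb, hi, pow_zero, ← map_one (algebraMap S R), Algebra.trace_algebraMap_of_basis b]
    simp
  · rw [Algebra.trace_eq_matrix_trace b, Matrix.trace]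
    suffices h0 : ∀ j, (Algebra.leftMulMatrix b (b i)).diag j = 0 from
      (Finset.sum_eq_zero fun j _ => h0 j) ▸ dvd_zero _
    intro j
    rw [Matrix.diag_apply, Algebra.leftMulMatrix_eq_repr_mul, hb, hb, ← pow_add]
    by_cases hij : (i : ℕ) + j < q
    · rw [← hb ⟨i + j, hij⟩, b.repr_self, Finsupp.single_apply, if_neg]
      intro h
      have := congrArg Fin.val h
      simp only at this
      omega
    · have hlt : (i : ℕ) + j - q < q := by omega
      have : z ^ ((i : ℕ) + j) = x • b ⟨i + j - q, hlt⟩ := by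
        rw [hb, Algebra.smul_def, ← hz, ← pow_add]
        congr 1
        simp only
        omega
      rw [this, map_smul, b.repr_self, Finsupp.smul_apply, Finsupp.single_apply, if_neg, smul_zero]
      intro h
      have := congrArg Fin.val h
      simp only at this
      omega

/-- The automorphisms of the pure extension `R = S[z]`, `z ^ q = x`, compute its norm and trace. -/
theorem exists_conjugates [CharZero S] (b : Basis (Fin q) S R) (hb : ∀ i, b i = z ^ (i : ℕ))
    (hz : z ^ q = algebraMap S R x) (hx : x ≠ 0) {k : ℕ} (hk : IsPrimitiveRoot (z ^ k) q) :
    ∃ (G : Type) (_ : Group G) (_ : Fintype G) (ρ : G →* (R →ₐ[S] R)),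
      (∀ σ, ∃ l, ρ σ z = z ^ l) ∧
      (∀ f, algebraMap S R (Algebra.norm S f) = ∏ σ, ρ σ f) ∧
      (∀ f, algebraMap S R (Algebra.trace S R f) = ∑ σ, ρ σ f) := by
  let pb : PowerBasis S R := ⟨z, q, b, hb⟩
  have hfree : Module.Free S R := .of_basis b
  have hfin : Module.Finite S R := .of_basis b
  let K := FractionRing S
  let M := FractionRing R
  let : Algebra K M := FractionRing.liftAlgebra S M
  have : IsScalarTower S K M := FractionRing.isScalarTower_liftAlgebra S M
  have : Algebra.IsAlgebraic S R := .of_finite S R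
  let bM : Basis (Fin q) K M := b.localizationLocalization K (nonZeroDivisors S) M
  have : FiniteDimensional K M := .of_basis bM
  set zM : M := algebraMap R M z with hzM
  have hbM (i) : bM i = zM ^ (i : ℕ) := by
    simp [bM, hb, zM]
  have hinj : Function.Injective (algebraMap R M) := IsFractionRing.injective R M
  have hzq : zM ^ q = algebraMap K M (algebraMap S K x) := by
    rw [hzM, ← map_pow, hz, ← IsScalarTower.algebraMap_apply, ← IsScalarTower.algebraMap_apply]
  have hq : q ≠ 0 := (Fin.pos_iff_nonempty.mpr b.index_nonempty).ne'
  have hroot : IsPrimitiveRoot (zM ^ k) q := by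
    rw [hzM, ← map_pow]; exact hk.map_of_injective hinj
  have hxK : algebraMap S K x ≠ 0 := by simpa using hx
  have : (X ^ q - C (algebraMap S K x)).IsSplittingField K M := by
    refine ⟨?_, ?_⟩
    · rw [Polynomial.map_sub, Polynomial.map_pow, map_X, map_C]
      exact X_pow_sub_C_splits_of_isPrimitiveRoot hroot hzq
    · rw [eq_top_iff]
      rintro y -
      rw [← bM.sum_repr y]
      refine Subalgebra.sum_mem _ fun i _ => Subalgebra.smul_mem _ ?_ _
      rw [hbM]
      refine Subalgebra.pow_mem _ (Algebra.subset_adjoin ?_) _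
      rw [mem_rootSet]
      refine ⟨(monic_X_pow_sub_C _ hq).ne_zero, by simp [hzq]⟩
  have : CharZero K := charZero_of_injective_algebraMap (FaithfulSMul.algebraMap_injective S K)
  have hgal : IsGalois K M :=
    .of_separable_splitting_field (separable_X_pow_sub_C _ (by exact_mod_cast hq) hxK)
  have hpow (σ : M ≃ₐ[K] M) : ∃ l, σ zM = zM ^ l := by
    have hx0 : zM ≠ 0 := by
      intro h
      rw [h, zero_pow hq] at hzq
      exact hxK ((map_eq_zero _).mp hzq.symm)
    have h1 : (σ zM / zM) ^ q = 1 := by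
      rw [div_pow, ← map_pow, hzq, AlgEquiv.commutes, div_self]
      simpa using hxK
    have : NeZero q := ⟨hq⟩
    obtain ⟨i, -, hi⟩ := hroot.eq_pow_of_pow_eq_one h1
    refine ⟨k * i + 1, ?_⟩
    rw [pow_succ, pow_mul, hi, div_mul_cancel₀ _ hx0]
  choose l hl using hpow
  have hlift (σ : M ≃ₐ[K] M) : aeval (z ^ l σ) (minpoly S pb.gen) = 0 := by
    change aeval _ (minpoly S z) = 0
    apply hinj
    rw [← aeval_algebraMap_apply, map_pow, ← hzM, ← hl, map_zero, minpoly_eq_X_pow_sub_C b hb hz]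
    simp only [map_sub, map_pow, aeval_X, aeval_C]
    rw [← map_pow, hzq, AlgEquiv.commutes, ← IsScalarTower.algebraMap_apply, sub_self]
  let ρ₀ (σ : M ≃ₐ[K] M) : R →ₐ[S] R := pb.lift _ (hlift σ)
  have hρz (σ) : ρ₀ σ z = z ^ l σ := pb.lift_gen _ (hlift σ)
  have hρ (σ) (f : R) : algebraMap R M (ρ₀ σ f) = σ (algebraMap R M f) := by
    have : ((IsScalarTower.toAlgHom S R M).comp (ρ₀ σ)) =
        ((σ : M →ₐ[K] M).restrictScalars S).comp (IsScalarTower.toAlgHom S R M) := by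
      apply pb.algHom_ext
      change algebraMap R M (ρ₀ σ z) = σ (algebraMap R M z)
      rw [hρz, map_pow, ← hzM, hl]
    exact DFunLike.congr_fun this f
  refine ⟨M ≃ₐ[K] M, inferInstance, inferInstance,
    { toFun := ρ₀, map_one' := ?_, map_mul' := ?_ }, fun σ => ⟨l σ, hρz σ⟩, ?_, ?_⟩
  · ext f; apply hinj; rw [hρ]; rfl
  · intro σ τ; ext f; apply hinj; rw [AlgHom.mul_apply, hρ, hρ, hρ]; rfl
  · intro f
    apply hinj
    simp only [MonoidHom.coe_mk, OneHom.coe_mk, map_prod, hρ]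
    rw [← Algebra.norm_eq_prod_automorphisms K, Algebra.norm_localization S (nonZeroDivisors S),
      ← IsScalarTower.algebraMap_apply, ← IsScalarTower.algebraMap_apply]
  · intro f
    apply hinj
    simp only [MonoidHom.coe_mk, OneHom.coe_mk, map_sum, hρ]
    rw [← trace_eq_sum_automorphisms (K := K), Algebra.trace_localization S (nonZeroDivisors S),
      ← IsScalarTower.algebraMap_apply, ← IsScalarTower.algebraMap_apply]

/-- If `D` is a derivation of `R` killing `z`, then the derivative of a norm is a trace. -/
theorem dvd_derivation_norm [CharZero S] (b : Basis (Fin q) S R) (hb : ∀ i, b i = z ^ (i : ℕ))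
    (hz : z ^ q = algebraMap S R x) (hx : x ≠ 0) {k : ℕ} (hk : IsPrimitiveRoot (z ^ k) q)
    {kS kR : Type} [CommRing kS] [CommRing kR] [Algebra kS S] [Algebra kR R]
    (DS : Derivation kS S S) (DR : Derivation kR R R)
    (hD : ∀ s, DR (algebraMap S R s) = algebraMap S R (DS s)) (hDz : DR z = 0) (f : R) :
    (q : S) ∣ DS (Algebra.norm S f) := by
  classical
  obtain ⟨G, _, _, ρ, hρz, hnorm, htrace⟩ := exists_conjugates b hb hz hx hk
  have hDpow (i : ℕ) : DR (z ^ i) = 0 := by simp [Derivation.leibniz_pow, hDz]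
  have hcomm (σ : G) (f : R) : DR (ρ σ f) = ρ σ (DR f) := by
    obtain ⟨l, hl⟩ := hρz σ
    rw [← b.sum_repr f]
    simp only [map_sum]
    refine Finset.sum_congr rfl fun i _ => ?_
    rw [Algebra.smul_def, hb, map_mul, map_pow, hl, ← pow_mul, AlgHom.commutes]
    simp [Derivation.leibniz, hDpow, hD, hl, ← pow_mul]
  have hprod (s : Finset G) (y : G → R) :
      DR (∏ σ ∈ s, y σ) = ∑ σ ∈ s, DR (y σ) * ∏ τ ∈ s.erase σ, y τ := by
    induction s using Finset.induction_on with
    | empty => simp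
    | insert a s ha ih =>
      rw [Finset.prod_insert ha, Derivation.leibniz, ih, Finset.sum_insert ha,
        Finset.erase_insert ha, smul_eq_mul, smul_eq_mul, add_comm, Finset.mul_sum, mul_comm (DR (y a))]
      congr 1
      refine Finset.sum_congr rfl fun σ hσ => ?_
      have hne : a ≠ σ := fun h => ha (h ▸ hσ)
      rw [Finset.erase_insert_of_ne hne, Finset.prod_insert (by simp [ha])]
      ring
  suffices h : DS (Algebra.norm S f) =
      Algebra.trace S R (DR f * ∏ τ ∈ Finset.univ.erase 1, ρ τ f) from
    h ▸ dvd_trace b hb hz _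
  have hinj : Function.Injective (algebraMap S R) := by
    have : Module.Free S R := .of_basis b
    exact FaithfulSMul.algebraMap_injective S R
  apply hinj
  rw [← hD, hnorm, hprod, htrace]
  refine Finset.sum_congr rfl fun σ _ => ?_
  rw [hcomm, map_mul, map_prod]
  congr 1
  refine (Finset.prod_bij (fun τ _ => σ * τ) ?_ ?_ ?_ ?_).symm
  · intro τ hτ
    simpa using hτ
  · intro _ _ _ _ h
    exact mul_left_cancel h
  · intro τ hτ
    refine ⟨σ⁻¹ * τ, ?_, by simp⟩
    simpa [inv_mul_eq_one, eq_comm] using hτ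
  · intro τ _
    rw [map_mul, AlgHom.mul_apply]

variable {F : Type} [CommRing F] [IsDomain F] {ψR : R →+* F} {ψS : S →+* F}

theorem one_sub_dvd_of_dvd_norm [CharZero S] (b : Basis (Fin q) S R)
    (hb : ∀ i, b i = z ^ (i : ℕ))
    (hz : z ^ q = algebraMap S R x) (hx : x ≠ 0) {k : ℕ} (hk : IsPrimitiveRoot (z ^ k) q)
    (hψR : ∀ f, ψR f = 0 ↔ 1 - z ∣ f) {f : R} (hf : 1 - x ∣ Algebra.norm S f) :
    1 - z ∣ f := by
  obtain ⟨G, _, _, ρ, hρz, hnorm, -⟩ := exists_conjugates b hb hz hx hk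
  let pb : PowerBasis S R := ⟨z, q, b, hb⟩
  have hρ (σ : G) : ψR (ρ σ f) = ψR f := by
    obtain ⟨l, hl⟩ := hρz σ
    obtain ⟨P, hP⟩ : ∃ P : S[X], f = aeval z P := pb.exists_eq_aeval' f
    rw [← sub_eq_zero, ← map_sub, hψR]
    have h1 : 1 - z ∣ z ^ l - z := by
      have h := sub_dvd_pow_sub_pow 1 z l
      rw [one_pow] at h
      have := dvd_sub (dvd_refl (1 - z)) h
      rwa [show 1 - z - (1 - z ^ l) = z ^ l - z by ring] at this
    refine h1.trans ?_
    rw [hP, ← aeval_algHom_apply, hl, aeval_def, aeval_def, ← eval_map, ← eval_map]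
    exact sub_dvd_eval_sub _ _ _
  have h0 : ψR (algebraMap S R (Algebra.norm S f)) = 0 := by
    rw [hψR]
    refine dvd_trans ?_ (map_dvd (algebraMap S R) hf)
    rw [map_sub, map_one, ← hz]
    simpa using sub_dvd_pow_sub_pow 1 z q
  rw [hnorm, map_prod, Finset.prod_congr rfl fun σ _ => hρ σ, Finset.prod_const] at h0
  exact (hψR f).mp (eq_zero_of_pow_eq_zero h0)

theorem exists_norm_eq_of_norm_eq_pow_mul [CharZero S] (b : Basis (Fin q) S R)
    (hb : ∀ i, b i = z ^ (i : ℕ))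
    (hz : z ^ q = algebraMap S R x) (hx : x ≠ 0) {k : ℕ} (hk : IsPrimitiveRoot (z ^ k) q)
    (hx1 : 1 - x ≠ 0)
    (hψR : ∀ f, ψR f = 0 ↔ 1 - z ∣ f) (m : ℕ) {f : R} {h : S}
    (hf : Algebra.norm S f = (1 - x) ^ m * h) : ∃ f' : R, Algebra.norm S f' = h := by
  induction m generalizing f with
  | zero => exact ⟨f, by simpa using hf⟩
  | succ m ih =>
    obtain ⟨f₁, rfl⟩ := one_sub_dvd_of_dvd_norm b hb hz hx hk hψR
      (f := f) ⟨(1 - x) ^ m * h, by rw [hf]; ring⟩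
    refine ih (f := f₁) (mul_left_cancel₀ hx1 ?_)
    rw [← mul_assoc, ← pow_succ', ← hf, map_mul, norm_one_sub_eq b hb hz]

theorem norm_ne_pow_mul_pow [CharZero S] [WfDvdMonoid S] (b : Basis (Fin q) S R)
    (hb : ∀ i, b i = z ^ (i : ℕ))
    (hz : z ^ q = algebraMap S R x) (hx : x ≠ 0) {k : ℕ} (hk : IsPrimitiveRoot (z ^ k) q)
    (hx1 : 1 - x ≠ 0)
    (hψS : ∀ f, ψS f = 0 ↔ 1 - x ∣ f) (hψR : ∀ f, ψR f = 0 ↔ 1 - z ∣ f)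
    {kS kR : Type} [CommRing kS] [CommRing kR] [Algebra kS S] [Algebra kR R]
    (DS : Derivation kS S S) (DR : Derivation kR R R)
    (hD : ∀ s, DR (algebraMap S R s) = algebraMap S R (DS s)) (hDz : DR z = 0)
    {p r t : ℕ} (hp0 : p ≠ 0) (hp : ψS p = 0) (hq : q = p ^ r) (ht : t < r)
    {u : S} (hDu : DS u = 1) (hu : ψS u ≠ 0) {g : S} (hg : g ≠ 0) (f : R) :
    Algebra.norm S f ≠ g ^ q * u ^ p ^ t := by
  intro hf
  have hunit : ¬ IsUnit (1 - x) := fun h => by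
    have h0 := (hψS (1 - x)).mpr dvd_rfl
    exact not_isUnit_zero (h0 ▸ h.map ψS)
  obtain ⟨m, g₁, hg₁, rfl⟩ := WfDvdMonoid.max_power_factor' hg hunit
  rw [mul_pow, ← pow_mul, mul_assoc] at hf
  obtain ⟨f', hf'⟩ := exists_norm_eq_of_norm_eq_pow_mul b hb hz hx hk hx1 hψR _ hf
  obtain ⟨c, hc⟩ := dvd_derivation_norm b hb hz hx hk DS DR hD hDz f'
  rw [hf', Derivation.leibniz, Derivation.leibniz_pow, Derivation.leibniz_pow, hDu] at hc
  simp only [smul_eq_mul, nsmul_eq_mul, mul_one] at hc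
  obtain ⟨e, rfl⟩ := Nat.exists_eq_add_of_lt ht
  have hpt : (p : S) ^ t ≠ 0 := pow_ne_zero _ (by exact_mod_cast hp0)
  have hqS : (q : S) = p ^ t * (p * p ^ e) := by rw [hq]; push_cast; ring
  have key : g₁ ^ q * u ^ (p ^ t - 1) =
      p * (p ^ e * (c - u ^ p ^ t * (g₁ ^ (q - 1) * DS g₁))) := by
    apply mul_left_cancel₀ hpt
    rw [hqS] at hc
    push_cast at hc
    linear_combination hc
  have h0 : ψS (g₁ ^ q * u ^ (p ^ t - 1)) = 0 := by
    rw [key, map_mul, hp, zero_mul]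
  rw [map_mul, map_pow, map_pow] at h0
  rcases mul_eq_zero.mp h0 with h | h
  · exact hg₁ ((hψS _).mp (eq_zero_of_pow_eq_zero h))
  · exact hu (eq_zero_of_pow_eq_zero h)

theorem norm_ne_algebraMap {K M : Type} [Field K] [Field M] [Algebra S K] [IsFractionRing S K]
    [Algebra R M] [IsFractionRing R M] [Algebra K M] [Algebra S M] [IsScalarTower S R M]
    [IsScalarTower S K M] (b : Basis (Fin q) S R) {v : S}
    (h : ∀ g : S, g ≠ 0 → ∀ f : R, Algebra.norm S f ≠ g ^ q * v) (a : M) :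
    Algebra.norm K a ≠ algebraMap S K v := by
  have hfree : Module.Free S R := .of_basis b
  have hfin : Module.Finite S R := .of_basis b
  have : Algebra.IsAlgebraic S R := .of_finite S R
  have hrank : finrank K M = q := by
    rw [finrank_eq_card_basis (b.localizationLocalization K (nonZeroDivisors S) M), Fintype.card_fin]
  obtain ⟨f, ⟨_, g, hg, rfl⟩, rfl⟩ :=
    IsLocalization.exists_mk'_eq (Algebra.algebraMapSubmonoid R (nonZeroDivisors S)) a
  have hg0 : g ≠ 0 := nonZeroDivisors.ne_zero hg
  intro ha
  apply h g hg0 f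
  apply IsFractionRing.injective S K
  have hspec : Algebra.norm K (_ * algebraMap R M (algebraMap S R g)) =
      Algebra.norm K (algebraMap R M f) :=
    congrArg (Algebra.norm K) (IsLocalization.mk'_spec M f
      (⟨algebraMap S R g, g, hg, rfl⟩ : Algebra.algebraMapSubmonoid R (nonZeroDivisors S)))
  rw [map_mul, ha, Algebra.norm_localization S (nonZeroDivisors S) f,
    ← IsScalarTower.algebraMap_apply, IsScalarTower.algebraMap_apply S K M,
    Algebra.norm_algebraMap, hrank] at hspec
  rw [← hspec, map_mul, map_pow, mul_comm]

end PureExtension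

section PowerSeries

variable {A B : Type} [CommRing A] [CommRing B] [Algebra A B]

theorem exists_basis_powerSeries {ι : Type} [Fintype ι] (b : Basis ι A B) :
    ∃ b' : Basis ι (PowerSeries A) (PowerSeries B), ∀ i, b' i = PowerSeries.C (b i) := by
  have hsmul (g : PowerSeries A) (c : B) (n : ℕ) :
      PowerSeries.coeff n (g • (PowerSeries.C c : PowerSeries B)) = PowerSeries.coeff n g • c := by
    rw [Algebra.smul_def, Algebra.smul_def, PowerSeries.coeff_mul_C]
    rfl
  have hli : LinearIndependent (PowerSeries A) fun i => (PowerSeries.C (b i) : PowerSeries B) := by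
    rw [Fintype.linearIndependent_iff]
    intro g hg i
    ext n
    have h := congrArg (PowerSeries.coeff n) hg
    simp only [map_sum, hsmul, map_zero] at h
    simpa using Fintype.linearIndependent_iff.mp b.linearIndependent _ h i
  refine ⟨Basis.mk hli ?_, fun i => Basis.mk_apply hli _ i⟩
  rintro f -
  have hf : f = ∑ i, (PowerSeries.mk fun n => b.repr (PowerSeries.coeff n f) i) •
      (PowerSeries.C (b i) : PowerSeries B) := by
    ext n
    simp only [map_sum, hsmul, PowerSeries.coeff_mk, b.sum_repr]
  rw [hf]
  exact Submodule.sum_mem _ fun i _ => Submodule.smul_mem _ _ (Submodule.subset_span ⟨i, rfl⟩)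

theorem map_powerSeries_eq_zero_iff {k : Type} [CommRing k] {φ : B →+* k} {c : B}
    (hφ : ∀ s, φ s = 0 ↔ c ∣ s) (f : PowerSeries B) :
    PowerSeries.map φ f = 0 ↔ PowerSeries.C c ∣ f := by
  constructor
  · intro h
    have h1 (n : ℕ) : ∃ d, PowerSeries.coeff n f = c * d := by
      rw [← dvd_def, ← hφ, ← PowerSeries.coeff_map, h, map_zero]
    choose d hd using h1
    refine ⟨PowerSeries.mk d, ?_⟩
    ext n
    simp [hd]
  · rintro ⟨g, rfl⟩
    rw [map_mul, PowerSeries.map_C, (hφ c).mpr dvd_rfl, map_zero, zero_mul]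

theorem norm_one_add_X_and_norm_ne [IsDomain A] [IsDomain B] [CharZero A] [IsNoetherianRing A]
    {K M : Type} [Field K] [Field M] [Algebra (PowerSeries A) K] [IsFractionRing (PowerSeries A) K]
    [Algebra (PowerSeries B) M] [IsFractionRing (PowerSeries B) M] [Algebra K M]
    (hKM : ∀ s : PowerSeries A, algebraMap K M (algebraMap _ K s) =
      algebraMap _ M (PowerSeries.map (algebraMap A B) s))
    {p r : ℕ} [Fact p.Prime] {x : A} {z : B} (b : Basis (Fin (p ^ r)) A B)
    (hb : ∀ i, b i = z ^ (i : ℕ)) (hz : z ^ p ^ r = algebraMap A B x) (hx : x ≠ 0)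
    (hx1 : 1 - x ≠ 0)
    {k : ℕ} (hk : IsPrimitiveRoot (z ^ k) (p ^ r))
    {φA : A →+* ZMod p} {φB : B →+* ZMod p}
    (hφA : ∀ s, φA s = 0 ↔ 1 - x ∣ s) (hφB : ∀ s, φB s = 0 ↔ 1 - z ∣ s)
    {u : K} (hu : u = algebraMap _ K (1 + PowerSeries.X : PowerSeries A)) :
    Algebra.norm K (algebraMap K M u) = u ^ p ^ r ∧
      ∀ t < r, ∀ a : M, Algebra.norm K a ≠ u ^ p ^ t := by
  let : Algebra (PowerSeries A) M :=
    ((algebraMap (PowerSeries B) M).comp (algebraMap (PowerSeries A) (PowerSeries B))).toAlgebra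
  have : IsScalarTower (PowerSeries A) (PowerSeries B) M := .of_algebraMap_eq fun _ => rfl
  have : IsScalarTower (PowerSeries A) K M := .of_algebraMap_eq fun s => (hKM s).symm
  obtain ⟨b', hb'⟩ := exists_basis_powerSeries b
  have hfree : Module.Free (PowerSeries A) (PowerSeries B) := .of_basis b'
  have hfin : Module.Finite (PowerSeries A) (PowerSeries B) := .of_basis b'
  have : Algebra.IsAlgebraic (PowerSeries A) (PowerSeries B) := .of_finite _ _
  have hrank : finrank K M = p ^ r := by
    rw [finrank_eq_card_basis
      (b'.localizationLocalization K (nonZeroDivisors (PowerSeries A)) M), Fintype.card_fin]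
  have hC : Function.Injective (PowerSeries.C (R := A)) := PowerSeries.C_injective
  have hC' : Function.Injective (PowerSeries.C (R := B)) := PowerSeries.C_injective
  have : CharZero (PowerSeries A) := charZero_of_injective_ringHom hC
  refine ⟨by rw [Algebra.norm_algebraMap, hrank], fun t ht a => ?_⟩
  rw [hu, ← map_pow]
  refine norm_ne_algebraMap b' (fun g hg f => ?_) a
  refine norm_ne_pow_mul_pow (x := PowerSeries.C x) (z := PowerSeries.C z) (k := k)
    (ψS := PowerSeries.map φA) (ψR := PowerSeries.map φB) b'
    (fun i => by rw [hb', hb, map_pow]) ?_ ?_ ?_ ?_ ?_ ?_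
    (PowerSeries.derivative A) (PowerSeries.derivative B)
    ?_ ?_ (NeZero.ne p) ?_ rfl ht ?_ ?_ hg f
  · rw [← map_pow, hz]
    exact (PowerSeries.map_C _ _).symm
  · exact (map_ne_zero_iff _ hC).mpr hx
  · rw [← map_pow]
    exact hk.map_of_injective hC'
  · rw [← map_one PowerSeries.C, ← map_sub]
    exact (map_ne_zero_iff _ hC).mpr hx1
  · rw [← map_one PowerSeries.C, ← map_sub]
    exact map_powerSeries_eq_zero_iff hφA
  · rw [← map_one PowerSeries.C, ← map_sub]
    exact map_powerSeries_eq_zero_iff hφB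
  · intro s
    ext n
    change PowerSeries.coeff n (PowerSeries.derivative B (PowerSeries.map (algebraMap A B) s)) =
      PowerSeries.coeff n (PowerSeries.map (algebraMap A B) (PowerSeries.derivative A s))
    simp [PowerSeries.coeff_derivative]
  · exact PowerSeries.derivative_C
  · rw [map_natCast, ← map_natCast PowerSeries.C, CharP.cast_eq_zero, map_zero]
  · change PowerSeries.derivative A (1 + PowerSeries.X) = 1
    simp
  · intro h
    have := congrArg (PowerSeries.coeff 0) h
    simp at this

end PowerSeries

section Cyclotomic

variable {p : ℕ} [Fact p.Prime]

theorem irreducible_cyclotomic_padicInt {m : ℕ} (hm : m ≠ 0) :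
    Irreducible (cyclotomic (p ^ m) ℤ_[p]) := by
  obtain ⟨n, rfl⟩ := Nat.exists_eq_succ_of_ne_zero hm
  have hE := cyclotomic_prime_pow_comp_X_add_one_isEisensteinAt p n
  set f : ℤ_[p][X] := (cyclotomic (p ^ (n + 1)) ℤ_[p]).comp (X + 1) with hf
  have hmap : ((cyclotomic (p ^ (n + 1)) ℤ).comp (X + 1)).map (Int.castRingHom ℤ_[p]) = f := by
    simp [hf, Polynomial.map_comp]
  have hmonic : f.Monic := by
    simpa [hf] using (cyclotomic.monic (p ^ (n + 1)) ℤ_[p]).comp_X_add_C 1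
  have hprime : Prime (p : ℤ_[p]) := PadicInt.prime_p
  have hfE : f.IsEisensteinAt (Ideal.span {(p : ℤ_[p])}) := by
    have hw := hE.isWeaklyEisensteinAt.map (Int.castRingHom ℤ_[p])
    rw [hmap, Ideal.map_span, Set.image_singleton] at hw
    refine ⟨?_, fun h => ?_, ?_⟩
    · rw [hmonic.leadingCoeff, Ideal.mem_span_singleton]
      exact fun h => hprime.not_isUnit (isUnit_of_dvd_one h)
    · simpa using hw.mem h
    · rw [coeff_zero_eq_eval_zero, hf, eval_comp]
      simp only [eval_add, eval_X, eval_one, zero_add]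
      rw [eval_one_cyclotomic_prime_pow, Ideal.span_singleton_pow, Ideal.mem_span_singleton]
      intro h
      have := (pow_dvd_pow_iff hprime.ne_zero hprime.not_isUnit (n := 2) (m := 1)).mp (by simpa using h)
      omega
  have hdeg : 0 < f.natDegree := by
    rw [hf, natDegree_comp, ← C_1, natDegree_X_add_C, mul_one, natDegree_cyclotomic]
    exact Nat.totient_pos.mpr (pow_pos (Fact.out : p.Prime).pos _)
  have hirr := hfE.irreducible ((Ideal.span_singleton_prime hprime.ne_zero).mpr hprime)
    hmonic.isPrimitive hdeg
  have h2 := (MulEquiv.irreducible_iff (algEquivAevalXAddC (1 : ℤ_[p]))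
    (x := cyclotomic (p ^ (n + 1)) ℤ_[p])).mp
  refine h2 ?_
  rw [algEquivAevalXAddC_apply, C_1, ← comp_eq_aeval]
  exact hirr

variable {E : Type} [Field E] [Algebra ℚ_[p] E] {m : ℕ} {ζ : E}

theorem minpoly_padic_eq_cyclotomic (hm : m ≠ 0) (hζ : IsPrimitiveRoot ζ (p ^ m)) :
    minpoly ℚ_[p] ζ = cyclotomic (p ^ m) ℚ_[p] := by
  have hpos : 0 < p ^ m := pow_pos (Fact.out : p.Prime).pos _
  have : CharZero E := charZero_of_injective_algebraMap (algebraMap ℚ_[p] E).injective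
  have hirr := ((cyclotomic.monic (p ^ m) ℤ_[p]).irreducible_iff_irreducible_map_fraction_map
    (K := ℚ_[p])).mp (irreducible_cyclotomic_padicInt hm)
  rw [map_cyclotomic] at hirr
  refine (minpoly.eq_of_irreducible_of_monic hirr ?_ (cyclotomic.monic _ _)).symm
  rw [aeval_def, ← eval_map, map_cyclotomic]
  exact hζ.isRoot_cyclotomic hpos

variable [Algebra ℤ_[p] E] [IsScalarTower ℤ_[p] ℚ_[p] E]

theorem minpoly_padicInt_eq_cyclotomic (hm : m ≠ 0) (hζ : IsPrimitiveRoot ζ (p ^ m)) :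
    minpoly ℤ_[p] ζ = cyclotomic (p ^ m) ℤ_[p] := by
  have hpos : 0 < p ^ m := pow_pos (Fact.out : p.Prime).pos _
  have : CharZero E := charZero_of_injective_algebraMap (algebraMap ℚ_[p] E).injective
  have hint : IsIntegral ℤ_[p] ζ := (hζ.isIntegral hpos).tower_top
  apply map_injective _ (IsFractionRing.injective ℤ_[p] ℚ_[p])
  rw [← minpoly.isIntegrallyClosed_eq_field_fractions' ℚ_[p] hint, map_cyclotomic,
    minpoly_padic_eq_cyclotomic hm hζ]

theorem exists_residue_hom (hm : m ≠ 0) (hζ : IsPrimitiveRoot ζ (p ^ m))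
    {O : Subalgebra ℤ_[p] E} (hO : O = Algebra.adjoin ℤ_[p] {ζ}) {z : O} (hz : (z : E) = ζ) :
    ∃ φ : O →+* ZMod p, ∀ s, φ s = 0 ↔ 1 - z ∣ s := by
  subst hO
  have hpos : 0 < p ^ m := pow_pos (Fact.out : p.Prime).pos _
  have : CharZero E := charZero_of_injective_algebraMap (algebraMap ℚ_[p] E).injective
  have hint : IsIntegral ℤ_[p] ζ := (hζ.isIntegral hpos).tower_top
  have : FaithfulSMul ℤ_[p] E := by
    rw [faithfulSMul_iff_algebraMap_injective, IsScalarTower.algebraMap_eq ℤ_[p] ℚ_[p] E]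
    exact (algebraMap ℚ_[p] E).injective.comp (IsFractionRing.injective ℤ_[p] ℚ_[p])
  let pb := Algebra.adjoin.powerBasis' hint
  have hgen : pb.gen = z := by
    rw [Algebra.adjoin.powerBasis'_gen]
    exact Subtype.ext hz.symm
  let : Algebra ℤ_[p] (ZMod p) := PadicInt.toZMod.toAlgebra
  obtain ⟨m, rfl⟩ := Nat.exists_eq_succ_of_ne_zero hm
  have hmin : minpoly ℤ_[p] pb.gen = cyclotomic (p ^ (m + 1)) ℤ_[p] := by
    rw [← Algebra.adjoin.powerBasis'_minpoly_gen hint, minpoly_padicInt_eq_cyclotomic hm hζ]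
  have h1 : aeval (1 : ZMod p) (minpoly ℤ_[p] pb.gen) = 0 := by
    rw [hmin, aeval_def, ← eval_map, map_cyclotomic, eval_one_cyclotomic_prime_pow]
    simp
  let φ := pb.lift 1 h1
  have hφz : φ z = 1 := by rw [← hgen]; exact pb.lift_gen 1 h1
  refine ⟨φ, fun s => ⟨fun hs => ?_, ?_⟩⟩
  · obtain ⟨P, rfl⟩ := pb.exists_eq_aeval' s
    rw [hgen] at hs ⊢
    have hdvd (Q : ℤ_[p][X]) : 1 - z ∣ algebraMap ℤ_[p] _ (eval 1 Q) - aeval z Q := by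
      have := sub_dvd_eval_sub 1 z (Q.map (algebraMap ℤ_[p] (Algebra.adjoin ℤ_[p] {ζ})))
      rwa [eval_map, eval_map, ← aeval_def, ← aeval_def, ← map_one (algebraMap ℤ_[p] _),
        aeval_algebraMap_apply, map_one, coe_aeval_eq_eval] at this
    have hp : 1 - z ∣ algebraMap ℤ_[p] _ (p : ℤ_[p]) := by
      have h := hdvd (cyclotomic (p ^ (m + 1)) ℤ_[p])
      rwa [eval_one_cyclotomic_prime_pow, ← hmin, ← hgen, minpoly.aeval, sub_zero, hgen] at h
    have hs' : PadicInt.toZMod (eval 1 P) = 0 := by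
      change φ _ = 0 at hs
      rw [← aeval_algHom_apply, hφz, ← map_one (algebraMap ℤ_[p] _), aeval_algebraMap_apply,
        coe_aeval_eq_eval] at hs
      exact hs
    have hmem : eval 1 P ∈ IsLocalRing.maximalIdeal ℤ_[p] := by
      rw [← PadicInt.ker_toZMod]
      exact hs'
    rw [PadicInt.maximalIdeal_eq_span_p, Ideal.mem_span_singleton] at hmem
    have := dvd_sub (hp.trans (map_dvd (algebraMap ℤ_[p] _) hmem)) (hdvd P)
    rwa [sub_sub_cancel] at this
  · rintro ⟨c, rfl⟩
    change φ _ = 0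
    rw [map_mul, map_sub, map_one, hφz, sub_self, zero_mul]

theorem exists_basis_cyclotomic {n r : ℕ} (hnr : r < n) (hζ : IsPrimitiveRoot ζ (p ^ n))
    (hE : IntermediateField.adjoin ℚ_[p] ({ζ} : Set E) = ⊤)
    {Oz Ox : Subalgebra ℤ_[p] E} (hOz : Oz = Algebra.adjoin ℤ_[p] {ζ})
    (hOx : Ox = Algebra.adjoin ℤ_[p] {ζ ^ p ^ r}) [Algebra Ox Oz]
    (halg : ∀ s : Ox, (algebraMap Ox Oz s : E) = s)
    {z : Oz} (hz : (z : E) = ζ) {x : Ox} (hx : (x : E) = ζ ^ p ^ r) :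
    ∃ b : Basis (Fin (p ^ r)) Ox Oz, ∀ i, b i = z ^ (i : ℕ) := by
  have hpp : p.Prime := Fact.out
  have hζr : IsPrimitiveRoot (ζ ^ p ^ r) (p ^ (n - r)) :=
    hζ.pow (pow_pos hpp.pos _) (by rw [← pow_add]; congr 1; omega)
  have : CharZero E := charZero_of_injective_algebraMap (algebraMap ℚ_[p] E).injective
  have hintζ : IsIntegral ℚ_[p] ζ := (hζ.isIntegral (pow_pos hpp.pos _)).tower_top
  have hintξ : IsIntegral ℚ_[p] (ζ ^ p ^ r) := hintζ.pow _
  let L := IntermediateField.adjoin ℚ_[p] {ζ ^ p ^ r}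
  have hfL : finrank ℚ_[p] L = (p ^ (n - r)).totient := by
    rw [IntermediateField.adjoin.finrank hintξ, minpoly_padic_eq_cyclotomic (by omega) hζr,
      natDegree_cyclotomic]
  have hfE : finrank ℚ_[p] E = (p ^ n).totient := by
    rw [← IntermediateField.finrank_top', ← hE,
      IntermediateField.adjoin.finrank hintζ, minpoly_padic_eq_cyclotomic (by omega) hζ,
      natDegree_cyclotomic]
  have hfLE : finrank L E = p ^ r := by
    have h := finrank_mul_finrank ℚ_[p] L E
    obtain ⟨d, rfl⟩ := Nat.exists_eq_add_of_lt hnr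
    rw [hfL, hfE, Nat.totient_prime_pow hpp (by omega), Nat.totient_prime_pow hpp (by omega)] at h
    have hpos : 0 < p ^ (r + d + 1 - r - 1) * (p - 1) :=
      Nat.mul_pos (pow_pos hpp.pos _) (by have := hpp.two_le; omega)
    apply Nat.eq_of_mul_eq_mul_left hpos
    rw [h, mul_right_comm, ← pow_add]
    congr 2
    omega
  have hLζ : IntermediateField.adjoin L ({ζ} : Set E) = ⊤ := by
    rw [← IntermediateField.restrictScalars_eq_top_iff (K := ℚ_[p]), eq_top_iff, ← hE,
      IntermediateField.adjoin_le_iff]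
    exact IntermediateField.subset_adjoin L _
  have hdeg : (minpoly L ζ).natDegree = p ^ r := by
    rw [← IntermediateField.adjoin.finrank hintζ.tower_top, hLζ, IntermediateField.finrank_top',
      hfLE]
  have hOxL (s : Ox) : (s : E) ∈ L := by
    have hs : (s : E) ∈ Algebra.adjoin ℤ_[p] {ζ ^ p ^ r} := hOx ▸ s.2
    have hle : Algebra.adjoin ℤ_[p] {ζ ^ p ^ r} ≤ L.toSubalgebra.restrictScalars ℤ_[p] := by
      rw [Algebra.adjoin_le_iff]
      exact IntermediateField.subset_adjoin ℚ_[p] {ζ ^ p ^ r}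
    exact hle hs
  have hli : LinearIndependent Ox fun i : Fin (p ^ r) => z ^ (i : ℕ) := by
    have hL : LinearIndependent L fun i : Fin (minpoly L ζ).natDegree => ζ ^ (i : ℕ) :=
      linearIndependent_pow ζ
    rw [hdeg, Fintype.linearIndependent_iff] at hL
    rw [Fintype.linearIndependent_iff]
    intro g hg i
    have h := congrArg (Subtype.val : Oz → E) hg
    have h2 := hL (fun i => ⟨g i, hOxL (g i)⟩) (by
      simpa [Algebra.smul_def, halg, hz] using h) i
    exact Subtype.ext (congrArg (Subtype.val : L → E) h2)
  refine ⟨Basis.mk hli ?_, fun i => Basis.mk_apply hli _ i⟩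
  have hpow (k : ℕ) : z ^ k ∈ Submodule.span Ox (Set.range fun i : Fin (p ^ r) => z ^ (i : ℕ)) := by
    have hlt : k % p ^ r < p ^ r := Nat.mod_lt _ (pow_pos hpp.pos _)
    have : z ^ k = x ^ (k / p ^ r) • z ^ (k % p ^ r) := by
      rw [Algebra.smul_def, map_pow, show algebraMap Ox Oz x = z ^ p ^ r from
        Subtype.ext (by rw [halg, hx]; simp [hz]), ← pow_mul, ← pow_add, Nat.div_add_mod]
    rw [this]
    exact Submodule.smul_mem _ _ (Submodule.subset_span ⟨⟨_, hlt⟩, rfl⟩)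
  rintro y -
  obtain ⟨P, hP⟩ : ∃ P : ℤ_[p][X], aeval ζ P = (y : E) := by
    have hy : (y : E) ∈ Algebra.adjoin ℤ_[p] {ζ} := hOz ▸ y.2
    rwa [Algebra.adjoin_singleton_eq_range_aeval] at hy
  have hy : y = ∑ i ∈ Finset.range (P.natDegree + 1), algebraMap ℤ_[p] Ox (P.coeff i) • z ^ i := by
    apply Subtype.ext
    rw [← hP, aeval_eq_sum_range]
    simp [Algebra.smul_def, halg, hz]
  rw [hy]
  exact Submodule.sum_mem _ fun i _ => Submodule.smul_mem _ _ (hpow i)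

end Cyclotomic



/-- Let `p` be an odd prime, `n > r ≥ 1`, `ζ` a primitive `p^n`-th root of unity
over `ℚ_p`, `ξ = ζ^(p^r)`, `L = ℚ_p(ξ)`.  Set `K = Frac(ℤ_p[ξ][[T]])` and
`M = Frac(ℤ_p[ζ][[T]])`, a Galois extension of `K` of degree `p^r` via the coefficientwise
inclusion, with norm map `N = N_{M/K}`.  Then the image of the element `1 + T` in the quotient
group `K^× / N(M^×)` has order exactly `p^r`; equivalently, `N(1 + T) = (1 + T)^(p^r)`, and for
every integer `t` with `0 ≤ t < r` there is no `a ∈ M^×` with `N(a) = (1 + T)^(p^t)`. -/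
theorem stmt_13 (p n r : ℕ) [Fact (Nat.Prime p)] (hp : Odd p) (hr : 1 ≤ r) (hnr : r < n)
    (E : Type) [Field E] [Algebra ℚ_[p] E] [Algebra ℤ_[p] E] [IsScalarTower ℤ_[p] ℚ_[p] E]
    (ζ : E) (hζ : IsPrimitiveRoot ζ (p ^ n))
    (hE : IntermediateField.adjoin ℚ_[p] ({ζ} : Set E) = ⊤)
    (𝒪ζ 𝒪ξ : Subalgebra ℤ_[p] E)
    (h𝒪ζ : 𝒪ζ = Algebra.adjoin ℤ_[p] ({ζ} : Set E))
    (h𝒪ξ : 𝒪ξ = Algebra.adjoin ℤ_[p] ({ζ ^ p ^ r} : Set E))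
    (hle : 𝒪ξ ≤ 𝒪ζ)
    [algKM : Algebra (FractionRing (PowerSeries ↥𝒪ξ)) (FractionRing (PowerSeries ↥𝒪ζ))]
    (halg : ∀ x : PowerSeries ↥𝒪ξ,
      algebraMap (FractionRing (PowerSeries ↥𝒪ξ)) (FractionRing (PowerSeries ↥𝒪ζ))
          (algebraMap (PowerSeries ↥𝒪ξ) (FractionRing (PowerSeries ↥𝒪ξ)) x) =
        algebraMap (PowerSeries ↥𝒪ζ) (FractionRing (PowerSeries ↥𝒪ζ))
          (PowerSeries.map (Subalgebra.inclusion hle).toRingHom x)) :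
    let u : FractionRing (PowerSeries ↥𝒪ξ) :=
      algebraMap (PowerSeries ↥𝒪ξ) (FractionRing (PowerSeries ↥𝒪ξ)) (1 + PowerSeries.X)
    Algebra.norm (FractionRing (PowerSeries ↥𝒪ξ))
        (algebraMap (FractionRing (PowerSeries ↥𝒪ξ)) (FractionRing (PowerSeries ↥𝒪ζ)) u) =
      u ^ p ^ r ∧
    ∀ t : ℕ, t < r → ∀ a : FractionRing (PowerSeries ↥𝒪ζ), a ≠ 0 →
      Algebra.norm (FractionRing (PowerSeries ↥𝒪ξ)) a ≠ u ^ p ^ t := by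
  have hpp : p.Prime := Fact.out
  have : CharZero E := charZero_of_injective_algebraMap (algebraMap ℚ_[p] E).injective
  have hζr : IsPrimitiveRoot (ζ ^ p ^ r) (p ^ (n - r)) :=
    hζ.pow (pow_pos hpp.pos _) (by rw [← pow_add]; congr 1; omega)
  have hnr' : n - r ≠ 0 := by omega
  let z : 𝒪ζ := ⟨ζ, h𝒪ζ ▸ Algebra.subset_adjoin rfl⟩
  let x : 𝒪ξ := ⟨ζ ^ p ^ r, h𝒪ξ ▸ Algebra.subset_adjoin rfl⟩
  let : Algebra 𝒪ξ 𝒪ζ := (Subalgebra.inclusion hle).toRingHom.toAlgebra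
  obtain ⟨b, hb⟩ := exists_basis_cyclotomic hnr hζ hE h𝒪ζ h𝒪ξ (fun _ => rfl)
    (z := z) rfl (x := x) rfl
  obtain ⟨φζ, hφζ⟩ := exists_residue_hom (by omega) hζ h𝒪ζ (z := z) rfl
  obtain ⟨φξ, hφξ⟩ := exists_residue_hom hnr' hζr h𝒪ξ (z := x) rfl
  have : IsNoetherianRing 𝒪ξ := by
    have : Algebra.FiniteType ℤ_[p] 𝒪ξ := by
      rw [h𝒪ξ]
      exact Algebra.FiniteType.adjoin_of_finite (Set.finite_singleton _)
    exact Algebra.FiniteType.isNoetherianRing ℤ_[p] 𝒪ξ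
  have hroot : IsPrimitiveRoot (z ^ p ^ (n - r)) (p ^ r) := by
    refine IsPrimitiveRoot.of_map_of_injective (f := 𝒪ζ.val) ?_ Subtype.val_injective
    rw [map_pow]
    exact hζ.pow (pow_pos hpp.pos _) (by rw [← pow_add]; congr 1; omega)
  have hx : x ≠ 0 := fun h =>
    pow_ne_zero _ (hζ.ne_zero (pow_pos hpp.pos _).ne') (congrArg Subtype.val h)
  have hx1 : 1 - x ≠ 0 := by
    rw [sub_ne_zero]
    intro h
    exact hζr.ne_one (Nat.one_lt_pow hnr' hpp.one_lt) (congrArg Subtype.val h).symm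
  have key := norm_one_add_X_and_norm_ne halg b hb rfl hx hx1 hroot hφξ hφζ rfl
  exact ⟨key.1, fun t ht a _ => key.2 t ht a⟩
end

section
/- Let p be a prime, r ≥ 1 an integer, and let 𝔽_p((X)) be the field of formal Laurent series over the field with p elements. Then the polynomial Y^{p^r} − (1 + X) is irreducible in the polynomial ring 𝔽_p((X))[Y]. -/
theorem Polynomial.irreducible_X_pow_sub_C_of_prime {R : Type*} [CommRing R] [IsDomain R]
    {a : R} (ha : Prime a) {n : ℕ} (hn : n ≠ 0) :
    Irreducible (Polynomial.X ^ n - Polynomial.C a : Polynomial R) := by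
  have hmonic := Polynomial.monic_X_pow_sub_C a hn
  have hprime : (Ideal.span {a}).IsPrime := (Ideal.span_singleton_prime ha.ne_zero).2 ha
  refine Polynomial.irreducible_of_eisenstein_criterion hprime ?_ ?_ ?_ ?_ hmonic.isPrimitive
  · rw [hmonic.leadingCoeff]
    exact hprime.one_notMem
  · intro k hk
    rw [Polynomial.degree_X_pow_sub_C hn.bot_lt, Nat.cast_lt] at hk
    rw [Polynomial.coeff_sub, Polynomial.coeff_X_pow, if_neg hk.ne, zero_sub, neg_mem_iff,
      Polynomial.coeff_C]
    split_ifs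
    · exact Ideal.mem_span_singleton_self a
    · exact zero_mem _
  · rw [Polynomial.degree_X_pow_sub_C hn.bot_lt]
    exact_mod_cast hn.bot_lt
  · rw [Polynomial.coeff_sub, Polynomial.coeff_X_pow, if_neg hn.symm, Polynomial.coeff_C_zero,
      zero_sub, neg_mem_iff, Ideal.span_singleton_pow, Ideal.mem_span_singleton]
    intro h
    have hdvd : a ^ 2 ∣ a ^ 1 := by rwa [pow_one]
    exact absurd ((pow_dvd_pow_iff ha.ne_zero ha.not_isUnit).1 hdvd) (by decide)

theorem LaurentSeries.irreducible_X_pow_sub_C_X (K : Type*) [Field K] {n : ℕ} (hn : n ≠ 0) :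
    Irreducible
      (Polynomial.X ^ n - Polynomial.C (HahnSeries.ofPowerSeries ℤ K PowerSeries.X) :
        Polynomial (LaurentSeries K)) := by
  have h := ((Polynomial.monic_X_pow_sub_C _ hn).irreducible_iff_irreducible_map_fraction_map
    (K := LaurentSeries K)).1
    (Polynomial.irreducible_X_pow_sub_C_of_prime (PowerSeries.X_prime (R := K)) hn)
  simpa only [Polynomial.map_sub, Polynomial.map_pow, Polynomial.map_X, Polynomial.map_C,
    LaurentSeries.coe_algebraMap] using h

/-- Let `p` be a prime, `r ≥ 1` an integer, and let `𝔽_p((X))` be the field of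
formal Laurent series over the field with `p` elements.  Then the polynomial `Y^(p^r) - (1 + X)`
is irreducible in the polynomial ring `𝔽_p((X))[Y]`. -/
theorem stmt_15 (p : ℕ) [Fact (Nat.Prime p)] (r : ℕ) (hr : 1 ≤ r) :
    Irreducible
      (Polynomial.X ^ p ^ r -
          Polynomial.C (1 + HahnSeries.ofPowerSeries ℤ (ZMod p) PowerSeries.X) :
        Polynomial (LaurentSeries (ZMod p))) := by
  have hchar : CharP (LaurentSeries (ZMod p)) p :=
    charP_of_injective_algebraMap (algebraMap (ZMod p) (LaurentSeries (ZMod p))).injective p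
  have hq : p ^ r ≠ 0 := pow_ne_zero r (Fact.out : p.Prime).ne_zero
  rw [← MulEquiv.irreducible_iff
    (Polynomial.algEquivAevalXAddC (1 : LaurentSeries (ZMod p)))]
  convert! LaurentSeries.irreducible_X_pow_sub_C_X (ZMod p) hq using 1
  simp only [map_sub, map_pow, Polynomial.algEquivAevalXAddC_apply, Polynomial.aeval_X,
    Polynomial.aeval_C, Polynomial.algebraMap_eq, map_add, map_one, add_pow_char_pow, one_pow]
  ring
end

section
/- Let p be an odd prime and i a positive integer coprime to p. Let ζ_i be a primitive i-th root of unity over ℚ_p and 𝓞_i = ℤ_p[ζ_i], the ring of integers of the unramified extension ℚ_p(ζ_i) of ℚ_p. Then the power series ring 𝓞_i[[T]], viewed as an algebra over ℤ_p[[T]] via the coefficientwise map, is a finite ℤ_p[[T]]-module and is an étale ℤ_p[[T]]-algebra (i.e. it is of finite presentation and formally étale). -/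
set_option synthInstance.maxHeartbeats 1000000
set_option maxHeartbeats 1000000

open Polynomial in
/-- A monogenic algebra `R[X]/(f)` with `f` monic and separable is étale. -/
theorem AdjoinRoot.etale_of_separable {R : Type*} [CommRing R] {f : R[X]} (hf : f.Monic)
    (hs : f.Separable) : Algebra.Etale R (AdjoinRoot f) := by
  obtain ⟨a, b, hab⟩ := hs
  let P : StandardEtalePair R :=
    { f := f, monic_f := hf, g := 1, cond := ⟨b, a, 1, by linear_combination hab⟩ }
  have hu : IsUnit (AdjoinRoot.mk f (1 : R[X])) := by simp
  let e : AdjoinRoot f ≃ₐ[R] Localization.Away (AdjoinRoot.mk f (1 : R[X])) :=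
    (IsLocalization.atUnit (AdjoinRoot f) (Localization.Away (AdjoinRoot.mk f (1 : R[X])))
      _ hu).restrictScalars R
  exact Algebra.Etale.of_equiv (P.equivAwayAdjoinRoot.trans e.symm)

/-- A finite basis of `S` over `R` is, via constant series, a basis of `S⟦X⟧` over `R⟦X⟧`. -/
noncomputable def PowerSeries.basisOfBasis {R S ι : Type*} [CommRing R] [CommRing S] [Algebra R S]
    [Fintype ι] (b : Module.Basis ι R S) :
    Module.Basis ι (PowerSeries R) (PowerSeries S) :=
  have coeff_smul_C (x : PowerSeries R) (s : S) (n : ℕ) :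
      PowerSeries.coeff n (x • PowerSeries.C s) = PowerSeries.coeff n x • s := by
    rw [Algebra.smul_def, PowerSeries.coeff_mul_C, Algebra.smul_def]
    rfl
  Module.Basis.mk (v := fun j ↦ PowerSeries.C (b j))
    (by
      rw [Fintype.linearIndependent_iff]
      intro g hg j
      ext n
      have h := congrArg (PowerSeries.coeff n) hg
      simp only [map_sum, coeff_smul_C, map_zero] at h
      simpa using Fintype.linearIndependent_iff.mp b.linearIndependent _ h j)
    (by
      intro x _
      have hx : x = ∑ j, (PowerSeries.mk fun n ↦ b.repr (PowerSeries.coeff n x) j) •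
          PowerSeries.C (b j) := by
        ext n
        simp only [map_sum, coeff_smul_C, PowerSeries.coeff_mk, b.sum_repr]
      rw [hx]
      exact Submodule.sum_mem _ fun j _ ↦
        Submodule.smul_mem _ _ (Submodule.subset_span ⟨j, rfl⟩))

theorem PowerSeries.basisOfBasis_apply {R S ι : Type*} [CommRing R] [CommRing S] [Algebra R S]
    [Fintype ι] (b : Module.Basis ι R S) (j : ι) :
    PowerSeries.basisOfBasis b j = PowerSeries.C (b j) := by
  simp [PowerSeries.basisOfBasis]

open TensorProduct in
/-- If `S` is finite free and étale over `R`, then `S⟦X⟧` is étale over `R⟦X⟧`. -/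
theorem PowerSeries.etale_of_basis {R S ι : Type*} [CommRing R] [CommRing S] [Algebra R S]
    [Fintype ι] (b : Module.Basis ι R S) [Algebra.Etale R S] :
    Algebra.Etale (PowerSeries R) (PowerSeries S) := by
  have : IsScalarTower R (PowerSeries R) (PowerSeries S) := .of_algebraMap_eq fun r ↦ by
    change _ = PowerSeries.map (algebraMap R S) (PowerSeries.C r)
    rw [PowerSeries.map_C, PowerSeries.algebraMap_apply]
  let c : S →ₐ[R] PowerSeries S := { PowerSeries.C with commutes' := fun _ ↦ PowerSeries.algebraMap_apply.symm }
  let φ : PowerSeries R ⊗[R] S →ₐ[PowerSeries R] PowerSeries S :=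
    Algebra.TensorProduct.lift (Algebra.ofId _ _) c fun _ _ ↦ .all _ _
  let e := (Algebra.TensorProduct.basis (PowerSeries R) b).equiv
    (PowerSeries.basisOfBasis b) (Equiv.refl ι)
  have he : φ.toLinearMap = e.toLinearMap := by
    refine (Algebra.TensorProduct.basis (PowerSeries R) b).ext fun j ↦ ?_
    rw [LinearEquiv.coe_coe, Module.Basis.equiv_apply, Equiv.refl_apply,
      PowerSeries.basisOfBasis_apply, Algebra.TensorProduct.basis_apply]
    simp [φ, c]
  have hφ : Function.Bijective φ := by
    have : ⇑φ = ⇑e := congrArg DFunLike.coe he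
    rw [this]
    exact e.bijective
  exact Algebra.Etale.of_equiv (AlgEquiv.ofBijective φ hφ)

/-- Let `p` be an odd prime and `i` a positive integer coprime to `p`.  Let
`ζ_i` be a primitive `i`-th root of unity over `ℚ_p` and `𝓞_i = ℤ_p[ζ_i]`, the ring of integers
of the unramified extension `ℚ_p(ζ_i)` of `ℚ_p`.  Then the power series ring `𝓞_i[[T]]`, viewed
as an algebra over `ℤ_p[[T]]` via the coefficientwise map, is a finite `ℤ_p[[T]]`-module and is
an étale `ℤ_p[[T]]`-algebra (i.e. it is of finite presentation and formally étale). -/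
theorem stmt_16 (p i : ℕ) [Fact (Nat.Prime p)] (hp : Odd p) (hi : 0 < i)
    (hpi : Nat.Coprime i p)
    (E : Type) [Field E] [Algebra ℚ_[p] E] [Algebra ℤ_[p] E] [IsScalarTower ℤ_[p] ℚ_[p] E]
    (ζ : E) (hζ : IsPrimitiveRoot ζ i)
    (𝓞 : Subalgebra ℤ_[p] E) (h𝓞 : 𝓞 = Algebra.adjoin ℤ_[p] ({ζ} : Set E)) :
    algebraMap (PowerSeries ℤ_[p]) (PowerSeries ↥𝓞) = PowerSeries.map (algebraMap ℤ_[p] ↥𝓞) ∧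
    Module.Finite (PowerSeries ℤ_[p]) (PowerSeries ↥𝓞) ∧
    Algebra.Etale (PowerSeries ℤ_[p]) (PowerSeries ↥𝓞) := by
  subst h𝓞
  have : FaithfulSMul ℤ_[p] E := by
    rw [faithfulSMul_iff_algebraMap_injective, IsScalarTower.algebraMap_eq ℤ_[p] ℚ_[p] E]
    exact (algebraMap ℚ_[p] E).injective.comp (IsFractionRing.injective ℤ_[p] ℚ_[p])
  have hroot : Polynomial.aeval ζ (Polynomial.X ^ i - Polynomial.C (1 : ℤ_[p])) = 0 := by
    simp [hζ.pow_eq_one]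
  have h_int : IsIntegral ℤ_[p] ζ := hζ.isIntegral hi |>.tower_top
  have hunit : IsUnit (i : ℤ_[p]) := by
    rw [PadicInt.isUnit_iff, PadicInt.norm_natCast_eq_one_iff]
    exact hpi.symm
  have hsep : (minpoly ℤ_[p] ζ).Separable := by
    refine Polynomial.Separable.of_dvd ?_ (minpoly.isIntegrallyClosed_dvd h_int hroot)
    exact Polynomial.separable_X_pow_sub_C_unit 1 hunit
  have := AdjoinRoot.etale_of_separable (minpoly.monic h_int) hsep
  have : Algebra.Etale ℤ_[p] (Algebra.adjoin ℤ_[p] ({ζ} : Set E)) :=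
    Algebra.Etale.of_equiv (minpoly.equivAdjoin h_int)
  let b := (Algebra.adjoin.powerBasis' h_int).basis
  exact ⟨rfl, .of_basis (PowerSeries.basisOfBasis b), PowerSeries.etale_of_basis b⟩
end
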